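/- Let 0 < p < 1. A Blaschke product B belongs to the multiplier algebra M(Q_p) if and only if B is a finite Blaschke product. -/

import Mathlib

open MeasureTheory Complex Metric Set Filter
open scoped ENNReal Real

noncomputable section

/-- The open unit disk in `ℂ`. -/
def unitDisk : Set ℂ := Metric.ball 0 1

/-- The Möbius automorphism `φ_a(z) = (a - z)/(1 - ā z)` of the unit disk. -/
def moebius (a z : ℂ) : ℂ := (a - z) / (1 - (starRingEnd ℂ) a * z)

/-- Membership in `H^∞(𝔻)`: bounded analytic functions on the unit disk. -/
def MemHinf (f : ℂ → ℂ) : Prop :=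
  DifferentiableOn ℂ f unitDisk ∧ ∃ M : ℝ, ∀ z ∈ unitDisk, ‖f z‖ ≤ M

/-- The integral `∫_𝔻 |f'(z)|² (1 - |φ_a(z)|²)^p dA(z)`. -/
def qpIntegral (p : ℝ) (f : ℂ → ℂ) (a : ℂ) : ℝ≥0∞ :=
  ∫⁻ z in unitDisk, ENNReal.ofReal (‖deriv f z‖ ^ 2 * (1 - ‖moebius a z‖ ^ 2) ^ p)

/-- Finiteness of the `H²`-part of the `Q_p` norm: the integrals of `|f|²` over circles of
radius `r < 1` are uniformly bounded (equivalently, the boundary integral `∫ |f|² dσ`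
is finite). -/
def h2Bounded (f : ℂ → ℂ) : Prop :=
  ∃ M : ℝ, ∀ r ∈ Set.Ico (0 : ℝ) 1,
    (∫ t in (0 : ℝ)..(2 * Real.pi), ‖f ((r : ℂ) * Complex.exp (Complex.I * t))‖ ^ 2) ≤ M

/-- Membership in the space `Q_p`: `f` is analytic on the unit disk and
`‖f‖_{Q_p}² = ∫_𝕋 |f|² dσ + sup_{a ∈ 𝔻} ∫_𝔻 |f'(z)|² (1 - |φ_a(z)|²)^p dA(z) < ∞`. -/
def MemQp (p : ℝ) (f : ℂ → ℂ) : Prop :=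
  DifferentiableOn ℂ f unitDisk ∧ h2Bounded f ∧
    ∃ C : ℝ, ∀ a ∈ unitDisk, qpIntegral p f a ≤ ENNReal.ofReal C

/-- The multiplier algebra `M(Q_p)`. -/
def MemMQp (p : ℝ) (φ : ℂ → ℂ) : Prop :=
  MemQp p φ ∧ ∀ f : ℂ → ℂ, MemQp p f → MemQp p (fun z => φ z * f z)

/-- The Carleson square `S(I)` over the arc of the unit circle centered at `e^{iθ}` with
normalized length `h`. -/
def carlesonBox (θ h : ℝ) : Set ℂ :=
  {z : ℂ | 1 - h < ‖z‖ ∧ ‖z‖ < 1 ∧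
    ∃ t : ℝ, |t - θ| < Real.pi * h ∧ z = (‖z‖ : ℂ) * Complex.exp (Complex.I * t)}

/-- A measure `μ` on the unit disk is a `p`-Carleson measure if `μ(S(I)) ≤ C |I|^p`
for every arc `I` of the unit circle. -/
def IsPCarleson (p : ℝ) (μ : Measure ℂ) : Prop :=
  ∃ C : ℝ, ∀ θ : ℝ, ∀ h ∈ Set.Ioc (0 : ℝ) 1,
    μ (carlesonBox θ h) ≤ ENNReal.ofReal (C * h ^ p)

/-- The `p`-Carleson constant `‖μ‖_p = sup_{I ⊂ 𝕋} μ(S(I))/|I|^p`. -/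
def pCarlesonNorm (p : ℝ) (μ : Measure ℂ) : ℝ≥0∞ :=
  ⨆ (θ : ℝ) (h : ℝ) (_ : h ∈ Set.Ioc (0 : ℝ) 1),
    μ (carlesonBox θ h) / ENNReal.ofReal (h ^ p)

/-- The measure `w(z) dA(z)` on the unit disk. -/
def diskMeasure (w : ℂ → ℝ) : Measure ℂ :=
  (volume.restrict unitDisk).withDensity fun z => ENNReal.ofReal (w z)

/-- The Wirtinger derivative `∂F/∂z`. -/
def wderiv (F : ℂ → ℂ) (z : ℂ) : ℂ :=
  (fderiv ℝ F z 1 - Complex.I * fderiv ℝ F z Complex.I) / 2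

/-- The Wirtinger derivative `∂F/∂z̄`. -/
def wderivBar (F : ℂ → ℂ) (z : ℂ) : ℂ :=
  (fderiv ℝ F z 1 + Complex.I * fderiv ℝ F z Complex.I) / 2

/-- The squared length of the (real) gradient: `|∇F|² = 2|∂F/∂z|² + 2|∂F/∂z̄|²`. -/
def gradSq (F : ℂ → ℂ) (z : ℂ) : ℝ :=
  2 * ‖wderiv F z‖ ^ 2 + 2 * ‖wderivBar F z‖ ^ 2

/-- The arc of the unit circle centered at `e^{iθ}` of normalized length `h`, parametrized
by angle. -/
def arcInterval (θ h : ℝ) : Set ℝ := Set.Ioo (θ - Real.pi * h) (θ + Real.pi * h)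

/-- The double integral `∫_I ∫_I |f(ξ) - f(η)|²/|ξ - η|^{2-p} |dξ| |dη|` over the arc
centered at `e^{iθ}` of normalized length `h`. -/
def qpTDouble (p : ℝ) (f : ℝ → ℂ) (θ h : ℝ) : ℝ≥0∞ :=
  ∫⁻ s in arcInterval θ h, ∫⁻ u in arcInterval θ h,
    ENNReal.ofReal (‖f s - f u‖ ^ 2 /
      ‖Complex.exp (Complex.I * s) - Complex.exp (Complex.I * u)‖ ^ (2 - p))

/-- The integral `∫_𝕋 |f|² dσ` of a function on the unit circle (parametrized by angle). -/
def l2Circle (f : ℝ → ℂ) : ℝ≥0∞ :=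
  ∫⁻ t in Set.Ioc (0 : ℝ) (2 * Real.pi), (‖f t‖₊ : ℝ≥0∞) ^ 2

/-- Membership in `Q_p(𝕋)` for a function on the unit circle (parametrized by angle):
`f ∈ L²(𝕋)` and `sup_{I ⊂ 𝕋} |I|^{-p} ∫_I ∫_I |f(ξ) - f(η)|²/|ξ - η|^{2-p} |dξ||dη| < ∞`. -/
def MemQpT (p : ℝ) (f : ℝ → ℂ) : Prop :=
  Function.Periodic f (2 * Real.pi) ∧ Measurable f ∧ l2Circle f < ⊤ ∧
    ∃ C : ℝ, ∀ θ : ℝ, ∀ h ∈ Set.Ioc (0 : ℝ) 1, qpTDouble p f θ h ≤ ENNReal.ofReal (C * h ^ p)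

/-- The square of the `Q_p` norm of an analytic function `f` on the disk with boundary
values `fb`. -/
def qpNormSq (p : ℝ) (f : ℂ → ℂ) (fb : ℝ → ℂ) : ℝ≥0∞ :=
  l2Circle fb + ⨆ a ∈ unitDisk, qpIntegral p f a

/-- The square of the `Q_p(𝕋)` norm of a function on the unit circle. -/
def qpTNormSq (p : ℝ) (fb : ℝ → ℂ) : ℝ≥0∞ :=
  l2Circle fb + ⨆ (θ : ℝ) (h : ℝ) (_ : h ∈ Set.Ioc (0 : ℝ) 1),
    qpTDouble p fb θ h / ENNReal.ofReal (h ^ p)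

/-- `fb` is the a.e. radial boundary-value function of `F`. -/
def RadialLimit (F : ℂ → ℂ) (fb : ℝ → ℂ) : Prop :=
  ∀ᵐ t : ℝ, Filter.Tendsto (fun r : ℝ => F ((r : ℂ) * Complex.exp (Complex.I * t)))
    (nhdsWithin 1 (Set.Iio 1)) (nhds (fb t))

/-- The Poisson integral (harmonic extension) of a function on the unit circle. -/
def poissonExt (f : ℝ → ℂ) (z : ℂ) : ℂ :=
  (1 / (2 * Real.pi)) • ∫ t in (0 : ℝ)..(2 * Real.pi),
    ((1 - ‖z‖ ^ 2) / ‖Complex.exp (Complex.I * t) - z‖ ^ 2) • f t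


/-- The Blaschke product `B(z) = z^m ∏_k (|a_k|/a_k) (a_k - z)/(1 - ā_k z)` associated to
a zero set `a : ι → ℂ` in `𝔻 \ {0}` satisfying the Blaschke condition, together with a
zero of order `m` at the origin. -/
def blaschkeProduct (m : ℕ) {ι : Type*} (a : ι → ℂ) (z : ℂ) : ℂ :=
  z ^ m * ∏' k, ((‖a k‖ : ℂ) / a k) * ((a k - z) / (1 - (starRingEnd ℂ) (a k) * z))

lemma mem_unitDisk {z : ℂ} : z ∈ unitDisk ↔ ‖z‖ < 1 := by simp [unitDisk]

lemma isOpen_unitDisk : IsOpen unitDisk := Metric.isOpen_ball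

lemma den_ne {a z : ℂ} (ha : ‖a‖ < 1) (hz : ‖z‖ ≤ 1) : 1 - (starRingEnd ℂ) a * z ≠ 0 := by
  intro h
  have h1 : (starRingEnd ℂ) a * z = 1 := (sub_eq_zero.mp h).symm
  have h2 : ‖(starRingEnd ℂ) a * z‖ = 1 := by rw [h1]; simp
  rw [norm_mul, RCLike.norm_conj] at h2
  nlinarith [norm_nonneg a, norm_nonneg z]

lemma norm_den_sq (a z : ℂ) : ‖1 - (starRingEnd ℂ) a * z‖ ^ 2 - ‖a - z‖ ^ 2
    = (1 - ‖a‖ ^ 2) * (1 - ‖z‖ ^ 2) := by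
  simp only [← Complex.normSq_eq_norm_sq, Complex.normSq_apply]
  simp
  ring

lemma one_sub_moebius {a z : ℂ} (h : 1 - (starRingEnd ℂ) a * z ≠ 0) :
    1 - ‖moebius a z‖ ^ 2 = (1 - ‖a‖ ^ 2) * (1 - ‖z‖ ^ 2) / ‖1 - (starRingEnd ℂ) a * z‖ ^ 2 := by
  rw [← norm_den_sq, moebius, norm_div, div_pow]
  have : ‖1 - (starRingEnd ℂ) a * z‖ ≠ 0 := norm_ne_zero_iff.mpr h
  rw [sub_div, div_self (pow_ne_zero 2 this)]

lemma moebius_mem {a z : ℂ} (ha : a ∈ unitDisk) (hz : z ∈ unitDisk) : moebius a z ∈ unitDisk := by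
  rw [mem_unitDisk] at *
  have hd := den_ne ha hz.le
  have h := one_sub_moebius hd
  have h1 : 0 < ‖1 - (starRingEnd ℂ) a * z‖ := norm_pos_iff.mpr hd
  have h2 : 0 < 1 - ‖a‖ ^ 2 := by nlinarith [norm_nonneg a]
  have h3 : 0 < 1 - ‖z‖ ^ 2 := by nlinarith [norm_nonneg z]
  have : 0 < 1 - ‖moebius a z‖ ^ 2 := by rw [h]; positivity
  nlinarith [norm_nonneg (moebius a z)]

lemma moebius_invol {a z : ℂ} (ha : a ∈ unitDisk) (hz : z ∈ unitDisk) :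
    moebius a (moebius a z) = z := by
  rw [mem_unitDisk] at *
  have hd := den_ne ha hz.le
  have hd2 := den_ne ha (z := a) ha.le
  have hd3 := den_ne ha (z := moebius a z) (mem_unitDisk.mp (moebius_mem (mem_unitDisk.mpr ha) (mem_unitDisk.mpr hz))).le
  have e : moebius a z * (1 - (starRingEnd ℂ) a * z) = a - z := by
    rw [moebius, div_mul_cancel₀ _ hd]
  rw [moebius, div_eq_iff hd3]
  generalize moebius a z = w at *
  apply mul_right_cancel₀ hd
  linear_combination (-1 + (starRingEnd ℂ) a * z) * e

lemma moebius_zero (a : ℂ) : moebius a 0 = a := by simp [moebius]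

lemma moebius_diffAt {a z : ℂ} (ha : ‖a‖ < 1) (hz : ‖z‖ ≤ 1) :
    DifferentiableAt ℂ (moebius a) z := by
  unfold moebius
  exact DifferentiableAt.div (by fun_prop) (by fun_prop) (den_ne ha hz)

/-- `|φ_a(z)| → 1` as `|z| → 1`. -/
lemma moebius_tendsto {a : ℂ} (ha : ‖a‖ < 1) :
    Tendsto (fun z => ‖moebius a z‖) (comap norm (nhdsWithin 1 (Iio 1))) (nhdsWithin 1 (Iio 1)) := by
  have hlt : ∀ᶠ z : ℂ in comap norm (nhdsWithin 1 (Iio 1)), ‖z‖ < 1 :=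
    (eventually_comap.mpr (by
      filter_upwards [self_mem_nhdsWithin] with b hb c hc
      rw [hc]; exact hb))
  refine tendsto_nhdsWithin_iff.mpr ⟨?_, ?_⟩
  swap
  · filter_upwards [hlt] with z hz
    exact mem_unitDisk.mp (moebius_mem (mem_unitDisk.mpr ha) (mem_unitDisk.mpr hz))
  have hn : Tendsto (fun z : ℂ => ‖z‖) (comap norm (nhdsWithin 1 (Iio 1))) (nhds 1) :=
    tendsto_comap.mono_right nhdsWithin_le_nhds
  have hlow : Tendsto (fun z : ℂ => 1 - (1 - ‖a‖ ^ 2) * (1 - ‖z‖ ^ 2) / (1 - ‖a‖) ^ 2)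
      (comap norm (nhdsWithin 1 (Iio 1))) (nhds 1) := by
    have := ((((hn.pow 2).const_sub 1).const_mul (1 - ‖a‖ ^ 2)).div_const ((1 - ‖a‖) ^ 2)).const_sub 1
    simpa using this
  refine tendsto_of_tendsto_of_tendsto_of_le_of_le' hlow tendsto_const_nhds ?_ ?_
  · filter_upwards [hlt] with z hz
    have hd := den_ne ha hz.le
    have h := one_sub_moebius hd
    have h1 : 1 - ‖a‖ ≤ ‖1 - (starRingEnd ℂ) a * z‖ := by
      have := norm_sub_norm_le (1 : ℂ) ((starRingEnd ℂ) a * z)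
      rw [norm_mul, RCLike.norm_conj, norm_one] at this
      nlinarith [norm_nonneg a, norm_nonneg z]
    have h2 : 0 < 1 - ‖a‖ ^ 2 := by nlinarith [norm_nonneg a]
    have h3 : 0 < 1 - ‖z‖ ^ 2 := by nlinarith [norm_nonneg z]
    have h4 : (1 - ‖a‖ ^ 2) * (1 - ‖z‖ ^ 2) / ‖1 - (starRingEnd ℂ) a * z‖ ^ 2 ≤
        (1 - ‖a‖ ^ 2) * (1 - ‖z‖ ^ 2) / (1 - ‖a‖) ^ 2 := by
      have : 0 < 1 - ‖a‖ := by linarith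
      gcongr
    have h5 := mem_unitDisk.mp (moebius_mem (mem_unitDisk.mpr ha) (mem_unitDisk.mpr hz))
    nlinarith [norm_nonneg (moebius a z)]
  · filter_upwards [hlt] with z hz
    exact (mem_unitDisk.mp (moebius_mem (mem_unitDisk.mpr ha) (mem_unitDisk.mpr hz))).le

lemma polar_lint (F : ℂ → ℝ≥0∞) (hF : Measurable F) :
    ∫⁻ z, F z = ∫⁻ t in Ioo (-π) π, ∫⁻ r in Ioi (0:ℝ),
      ENNReal.ofReal r * F ((r : ℂ) * Complex.exp (Complex.I * t)) := by
  rw [← Complex.lintegral_comp_polarCoord_symm, polarCoord_target, Measure.volume_eq_prod,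
    ← Measure.prod_restrict, lintegral_prod_symm]
  · refine lintegral_congr fun t => lintegral_congr fun r => ?_
    rw [Complex.polarCoord_symm_apply, mul_comm Complex.I, Complex.exp_mul_I]
    simp
  · apply Measurable.aemeasurable
    have : Measurable (fun p : ℝ × ℝ => Complex.polarCoord.symm p) := by
      simp_rw [Complex.polarCoord_symm_apply]; fun_prop
    simp only [smul_eq_mul]
    fun_prop

lemma polar_lint2 (F : ℂ → ℝ≥0∞) (hF : Measurable F) :
    ∫⁻ z, F z = ∫⁻ r in Ioi (0:ℝ), ∫⁻ t in Ioo (-π) π,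
      ENNReal.ofReal r * F ((r : ℂ) * Complex.exp (Complex.I * t)) := by
  rw [← Complex.lintegral_comp_polarCoord_symm, polarCoord_target, Measure.volume_eq_prod,
    ← Measure.prod_restrict, lintegral_prod]
  · refine lintegral_congr fun t => lintegral_congr fun r => ?_
    rw [Complex.polarCoord_symm_apply, mul_comm Complex.I, Complex.exp_mul_I]
    simp
  · apply Measurable.aemeasurable
    have : Measurable (fun p : ℝ × ℝ => Complex.polarCoord.symm p) := by
      simp_rw [Complex.polarCoord_symm_apply]; fun_prop
    simp only [smul_eq_mul]
    fun_prop

/-- Conformal invariance. -/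
lemma conf_inv (p : ℝ) (F : ℂ → ℂ) (hF : DifferentiableOn ℂ F unitDisk) {a : ℂ}
    (ha : a ∈ unitDisk) :
    qpIntegral p (fun z => F (moebius a z)) 0 ≤ qpIntegral p F a := by
  have hd : ∀ z ∈ unitDisk, HasDerivAt (moebius a) (deriv (moebius a) z) z := fun z hz =>
    (moebius_diffAt (mem_unitDisk.mp ha) (mem_unitDisk.mp hz).le).hasDerivAt
  have hinj : InjOn (moebius a) unitDisk := fun x hx y hy h => by
    rw [← moebius_invol ha hx, h, moebius_invol ha hy]
  have key := lintegral_image_eq_lintegral_abs_det_fderiv_mul volume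
    isOpen_unitDisk.measurableSet
    (fun z hz => ((hd z hz).hasFDerivAt.restrictScalars ℝ).hasFDerivWithinAt) hinj
    (fun z => ENNReal.ofReal (‖deriv F z‖ ^ 2 * (1 - ‖moebius a z‖ ^ 2) ^ p))
  have hsub : moebius a '' unitDisk ⊆ unitDisk := by
    rintro _ ⟨z, hz, rfl⟩; exact moebius_mem ha hz
  refine le_trans (le_of_eq ?_) (lintegral_mono_set hsub)
  rw [key]
  refine setLIntegral_congr_fun isOpen_unitDisk.measurableSet fun z hz => ?_
  have hc : deriv (fun z => F (moebius a z)) z = deriv F (moebius a z) * deriv (moebius a) z := by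
    exact deriv_comp z (hF.differentiableAt (isOpen_unitDisk.mem_nhds (moebius_mem ha hz)))
      (hd z hz).differentiableAt
  rw [hc, moebius_invol ha hz, ← ENNReal.ofReal_mul (abs_nonneg _)]
  have hdet : |(ContinuousLinearMap.restrictScalars ℝ
      (ContinuousLinearMap.toSpanSingleton ℂ (deriv (moebius a) z))).det|
      = ‖deriv (moebius a) z‖ ^ 2 := by
    simp [ContinuousLinearMap.det, LinearMap.det_restrictScalars, Algebra.norm_complex_eq,
      Complex.normSq_eq_norm_sq]
  rw [hdet, norm_mul]
  congr 1
  simp [moebius]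
  ring

lemma circ_lint {φ : ℝ → ℝ} (hc : Continuous φ) (h0 : ∀ t, 0 ≤ φ t)
    (hper : Function.Periodic φ (2 * π)) :
    ∫⁻ t in Ioo (-π) π, ENNReal.ofReal (φ t) = ENNReal.ofReal (∫ t in (0:ℝ)..(2 * π), φ t) := by
  have h1 : ∫ t in (0:ℝ)..(2 * π), φ t = ∫ t in (-π)..π, φ t := by
    have := hper.intervalIntegral_add_eq 0 (-π)
    rw [show (0:ℝ) + 2 * π = 2 * π by ring, show -π + 2 * π = π by ring] at this
    exact this
  rw [h1, intervalIntegral.integral_of_le (by linarith [Real.pi_pos]),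
    ← setLIntegral_congr Ioo_ae_eq_Ioc.symm, ofReal_integral_eq_lintegral_ofReal]
  · exact (hc.intervalIntegrable (-π) π).1
  · exact Eventually.of_forall h0

lemma exp_per (t : ℝ) : Complex.exp (Complex.I * ((t + 2 * π : ℝ) : ℂ)) = Complex.exp (Complex.I * t) := by
  have := Complex.exp_periodic (Complex.I * t)
  rw [← this]
  congr 1
  push_cast
  ring

lemma norm_rexp {r : ℝ} (hr : 0 ≤ r) (t : ℝ) : ‖(r : ℂ) * Complex.exp (Complex.I * t)‖ = r := by
  rw [norm_mul, mul_comm Complex.I, Complex.norm_exp_ofReal_mul_I]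
  simp [abs_of_nonneg hr]

lemma circ_cont {h : ℂ → ℂ} {c : ℂ} {δ r : ℝ} (hh : ContinuousOn h (ball c δ)) (hr : 0 ≤ r)
    (hrd : r < δ) : Continuous fun t : ℝ => h (c + (r : ℂ) * Complex.exp (Complex.I * t)) := by
  refine hh.comp_continuous (by fun_prop) fun t => ?_
  simp only [mem_ball, dist_self_add_left]
  rw [norm_rexp hr]; exact hrd

lemma mvp {h : ℂ → ℂ} {c : ℂ} {δ r : ℝ} (hh : DifferentiableOn ℂ h (ball c δ)) (hr : 0 ≤ r)
    (hrd : r < δ) : 2 * π * ‖h c‖ ^ 2 ≤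
      ∫ t in (0:ℝ)..(2 * π), ‖h (c + (r : ℂ) * Complex.exp (Complex.I * t))‖ ^ 2 := by
  have h1 : DiffContOnCl ℂ (fun z => h z ^ 2) (ball c |r|) := by
    apply DifferentiableOn.diffContOnCl_ball (U := ball c δ) (hh.pow 2)
    rw [abs_of_nonneg hr]
    exact closedBall_subset_ball hrd
  have h2 := h1.circleAverage
  rw [Real.circleAverage] at h2
  have h3 : ‖h c‖ ^ 2 ≤ (2 * π)⁻¹ * ∫ t in (0:ℝ)..(2 * π), ‖h (c + (r : ℂ) * Complex.exp (Complex.I * t))‖ ^ 2 := by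
    rw [← norm_pow, ← h2, norm_smul, Real.norm_of_nonneg (by positivity)]
    gcongr
    refine (intervalIntegral.norm_integral_le_integral_norm (by positivity)).trans_eq ?_
    simp [circleMap, mul_comm Complex.I]
  have hp : 0 < 2 * π := by positivity
  calc _ ≤ 2 * π * ((2 * π)⁻¹ * ∫ t in (0:ℝ)..(2 * π), ‖h (c + (r : ℂ) * Complex.exp (Complex.I * t))‖ ^ 2) := by gcongr
    _ = _ := by rw [← mul_assoc, mul_inv_cancel₀ hp.ne', one_mul]

lemma mvp_lint {h : ℂ → ℂ} {c : ℂ} {δ r : ℝ} (hh : DifferentiableOn ℂ h (ball c δ)) (hr : 0 ≤ r)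
    (hrd : r < δ) : ENNReal.ofReal (2 * π * ‖h c‖ ^ 2) ≤
      ∫⁻ t in Ioo (-π) π, ENNReal.ofReal (‖h (c + (r : ℂ) * Complex.exp (Complex.I * t))‖ ^ 2) := by
  rw [circ_lint]
  · exact ENNReal.ofReal_le_ofReal (mvp hh hr hrd)
  · exact (circ_cont hh.continuousOn hr hrd).norm.pow 2
  · intro t; positivity
  · intro t
    simp only
    rw [exp_per]

lemma qp0 (p : ℝ) (G : ℂ → ℂ) : qpIntegral p G 0 =
    ∫⁻ z in unitDisk, ENNReal.ofReal (‖deriv G z‖ ^ 2 * (1 - ‖z‖ ^ 2) ^ p) := by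
  simp [qpIntegral, moebius]

lemma deriv_bound {p : ℝ} (hp0 : 0 < p) (hp1 : p < 1) {G : ℂ → ℂ}
    (hG : DifferentiableOn ℂ G unitDisk) {C : ℝ} (hC : 0 ≤ C)
    (hq : qpIntegral p G 0 ≤ ENNReal.ofReal C) {w : ℂ} (hw : ‖w‖ ≤ 1 / 2) :
    ‖deriv G w‖ ^ 2 ≤ 100 * C := by
  have hsub : ball w (1/4) ⊆ unitDisk := by
    intro z hz
    rw [mem_unitDisk]
    rw [mem_ball, dist_eq_norm] at hz
    have := norm_le_norm_add_norm_sub' z w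
    linarith
  have hGd : DifferentiableOn ℂ (deriv G) (ball w (1/4)) := (hG.deriv isOpen_unitDisk).mono hsub
  have hm : Measurable (deriv G) := measurable_deriv G
  have h1 : ∫⁻ z in ball w (1/4), ENNReal.ofReal (‖deriv G z‖ ^ 2) ≤ ENNReal.ofReal (16 / 7 * C) := by
    calc ∫⁻ z in ball w (1/4), ENNReal.ofReal (‖deriv G z‖ ^ 2)
        ≤ ∫⁻ z in ball w (1/4), ENNReal.ofReal (16 / 7) * ENNReal.ofReal (‖deriv G z‖ ^ 2 * (1 - ‖z‖ ^ 2) ^ p) := by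
          refine setLIntegral_mono' measurableSet_ball fun z hz => ?_
          rw [← ENNReal.ofReal_mul (by norm_num)]
          apply ENNReal.ofReal_le_ofReal
          rw [mem_ball, dist_eq_norm] at hz
          have := norm_le_norm_add_norm_sub' z w
          have h2 : 7 / 16 ≤ 1 - ‖z‖ ^ 2 := by nlinarith [norm_nonneg z]
          have h3 := Real.self_le_rpow_of_le_one (x := 1 - ‖z‖ ^ 2) (by linarith) (by nlinarith [norm_nonneg z]) hp1.le
          nlinarith [sq_nonneg ‖deriv G z‖]
      _ ≤ ∫⁻ z in unitDisk, ENNReal.ofReal (16 / 7) * ENNReal.ofReal (‖deriv G z‖ ^ 2 * (1 - ‖z‖ ^ 2) ^ p) :=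
          lintegral_mono_set hsub
      _ = ENNReal.ofReal (16 / 7) * qpIntegral p G 0 := by
          rw [qp0, lintegral_const_mul' _ _ (by simp)]
      _ ≤ _ := by rw [ENNReal.ofReal_mul (by norm_num)]; gcongr
  have h2 : ∫⁻ z in ball w (1/4), ENNReal.ofReal (‖deriv G z‖ ^ 2) =
      ∫⁻ u, (ball (0:ℂ) (1/4)).indicator (fun u => ENNReal.ofReal (‖deriv G (w + u)‖ ^ 2)) u := by
    rw [← lintegral_indicator measurableSet_ball, ← lintegral_add_left_eq_self _ w]
    refine lintegral_congr fun u => ?_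
    by_cases hu : ‖u‖ < 1/4
    · rw [indicator_of_mem (by simpa using hu), indicator_of_mem (by simpa using hu)]
    · rw [indicator_of_notMem (by simpa using hu), indicator_of_notMem (by simpa using hu)]
  rw [h2, polar_lint2 _ (Measurable.indicator (by fun_prop) measurableSet_ball)] at h1
  have h3 : ∫⁻ r in Ioo (1/8:ℝ) (1/4), ENNReal.ofReal (1/8) * ENNReal.ofReal (2 * π * ‖deriv G w‖ ^ 2)
      ≤ ENNReal.ofReal (16 / 7 * C) := by
    refine le_trans ?_ h1
    refine le_trans (setLIntegral_mono' measurableSet_Ioo fun r hr => ?_)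
      (lintegral_mono_set (s := Ioo (1/8:ℝ) (1/4)) fun r hr => ?_)
    · have hr0 : 0 ≤ r := by linarith [hr.1]
      rw [lintegral_const_mul' _ _ (by simp)]
      gcongr
      · exact hr.1.le
      · refine (mvp_lint hGd hr0 hr.2).trans_eq ?_
        refine lintegral_congr fun t => ?_
        rw [indicator_of_mem]
        simp only [mem_ball, dist_zero_right]
        rw [norm_rexp hr0]; exact hr.2
    · have := hr.1
      simp only [mem_Ioi]; linarith
  rw [setLIntegral_const, Real.volume_Ioo, ← ENNReal.ofReal_mul (by norm_num),
    ← ENNReal.ofReal_mul (by positivity), ENNReal.ofReal_le_ofReal_iff (by positivity)] at h3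
  have := Real.pi_gt_three
  nlinarith [sq_nonneg ‖deriv G w‖]

lemma near_zero {p : ℝ} (hp0 : 0 < p) (hp1 : p < 1) {G : ℂ → ℂ}
    (hG : DifferentiableOn ℂ G unitDisk) {C : ℝ} (hC : 0 ≤ C)
    (hq : qpIntegral p G 0 ≤ ENNReal.ofReal C) {w : ℂ} (hw : ‖w‖ ≤ 1 / 2) :
    ‖G w - G 0‖ ^ 2 ≤ 25 * C := by
  have hb : ∀ x ∈ closedBall (0:ℂ) (1/2), ‖deriv G x‖ ≤ Real.sqrt (100 * C) := fun x hx => by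
    apply Real.le_sqrt_of_sq_le
    exact deriv_bound hp0 hp1 hG hC hq (by simpa using hx)
  have hd : ∀ x ∈ closedBall (0:ℂ) (1/2), DifferentiableAt ℂ G x := fun x hx => by
    refine hG.differentiableAt (isOpen_unitDisk.mem_nhds ?_)
    rw [mem_unitDisk]
    have : ‖x‖ ≤ 1/2 := by simpa using hx
    linarith
  have h := Convex.norm_image_sub_le_of_norm_deriv_le hd hb (convex_closedBall 0 (1/2))
    (x := 0) (y := w) (by simp) (by simpa using hw)
  have h2 : ‖G w - G 0‖ ≤ Real.sqrt (100 * C) * (1/2) := by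
    refine h.trans ?_
    gcongr
    simpa using hw
  calc ‖G w - G 0‖ ^ 2 ≤ (Real.sqrt (100 * C) * (1/2)) ^ 2 := by gcongr
    _ = 25 * C := by rw [mul_pow, Real.sq_sqrt (by positivity)]; ring

lemma cs_radial {p : ℝ} (hp0 : 0 < p) (hp1 : p < 1) {N : ℝ → ℝ} {R : ℝ} (hR : 1/2 ≤ R) (hR1 : R < 1)
    (hN : ContinuousOn N (Icc (1/2) R)) :
    (∫ s in (1/2:ℝ)..R, N s) ^ 2 ≤ (1 / (1 - p)) * ∫ s in (1/2:ℝ)..R, N s ^ 2 * (1 - s) ^ p := by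
  have hpos : ∀ s ∈ Icc (1/2) R, 0 < 1 - s := fun s hs => by linarith [hs.2]
  have hu : uIcc (1/2) R = Icc (1/2) R := uIcc_of_le hR
  have hc1 : ContinuousOn (fun s : ℝ => (1 - s) ^ p) (Icc (1/2) R) :=
    ContinuousOn.rpow_const (by fun_prop) fun s hs => Or.inl (hpos s hs).ne'
  have hc2 : ContinuousOn (fun s : ℝ => (1 - s) ^ (-p)) (Icc (1/2) R) :=
    ContinuousOn.rpow_const (by fun_prop) fun s hs => Or.inl (hpos s hs).ne'
  have i1 : IntervalIntegrable (fun s => N s ^ 2 * (1 - s) ^ p) volume (1/2) R :=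
    ContinuousOn.intervalIntegrable (by rw [hu]; exact (hN.pow 2).mul hc1)
  have i2 : IntervalIntegrable N volume (1/2) R :=
    ContinuousOn.intervalIntegrable (by rw [hu]; exact hN)
  have i3 : IntervalIntegrable (fun s : ℝ => (1 - s) ^ (-p)) volume (1/2) R :=
    ContinuousOn.intervalIntegrable (by rw [hu]; exact hc2)
  have hq : 0 < 1 - p := by linarith
  have hY : ∫ s in (1/2:ℝ)..R, (1 - s) ^ (-p) ≤ 1 / (1 - p) := by
    have hd : ∀ s ∈ uIcc (1/2) R, HasDerivAt (fun s : ℝ => - ((1 - s) ^ (1 - p) / (1 - p))) ((1 - s) ^ (-p)) s := by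
      intro s hs
      rw [hu] at hs
      have h1 : HasDerivAt (fun s : ℝ => 1 - s) (-1) s := by
        simpa using (hasDerivAt_id s).const_sub 1
      have h2 := ((h1.rpow_const (p := 1 - p) (Or.inl (hpos s hs).ne')).div_const (1 - p)).neg
      have h3 : -(-1 * (1 - p) * (1 - s) ^ (1 - p - 1) / (1 - p)) = (1 - s) ^ (-p) := by
        rw [show 1 - p - 1 = -p by ring]
        field_simp
      rw [h3] at h2
      exact h2
    rw [intervalIntegral.integral_eq_sub_of_hasDerivAt hd i3]
    have a1 : 0 ≤ (1 - R) ^ (1 - p) / (1 - p) := by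
      have : 0 ≤ 1 - R := by linarith
      positivity
    have a2 : (1 - 1/2 : ℝ) ^ (1 - p) ≤ 1 := Real.rpow_le_one (by norm_num) (by norm_num) hq.le
    have a3 : (1 - 1/2 : ℝ) ^ (1 - p) / (1 - p) ≤ 1 / (1 - p) := by gcongr
    linarith
  set A := ∫ s in (1/2:ℝ)..R, N s with hA
  set X := ∫ s in (1/2:ℝ)..R, N s ^ 2 * (1 - s) ^ p with hX
  set Y := ∫ s in (1/2:ℝ)..R, (1 - s) ^ (-p) with hYd
  set l := A * (1 - p) with hl
  have hmain : 0 ≤ X - 2 * l * A + l ^ 2 * Y := by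
    have e : X - 2 * l * A + l ^ 2 * Y =
        ∫ s in (1/2:ℝ)..R, (N s ^ 2 * (1 - s) ^ p - 2 * l * N s + l ^ 2 * (1 - s) ^ (-p)) := by
      rw [intervalIntegral.integral_add (i1.sub (i2.const_mul _)) (i3.const_mul _),
        intervalIntegral.integral_sub i1 (i2.const_mul _), intervalIntegral.integral_const_mul,
        intervalIntegral.integral_const_mul]
    rw [e]
    refine intervalIntegral.integral_nonneg hR fun s hs => ?_
    have h1 := hpos s hs
    have hu : (1 - s) ^ p * (1 - s) ^ (-p) = 1 := by
      rw [← Real.rpow_add h1]; simp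
    have h2 : 0 < (1 - s) ^ (-p) := Real.rpow_pos_of_pos h1 _
    have h3 : N s ^ 2 * (1 - s) ^ p - 2 * l * N s + l ^ 2 * (1 - s) ^ (-p)
        = (1 - s) ^ (-p) * (N s * (1 - s) ^ p - l) ^ 2 := by
      linear_combination (-(N s ^ 2 * (1 - s) ^ p) + 2 * N s * l) * hu
    rw [h3]; positivity
  have h5 : l ^ 2 * Y ≤ l ^ 2 * (1 / (1 - p)) := by gcongr
  have h6 : l ^ 2 * (1 / (1 - p)) = l * A := by rw [hl]; field_simp
  have h7 : l * A ≤ X := by nlinarith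
  rw [hl] at h7
  rw [div_mul_eq_mul_div, le_div_iff₀ hq]
  linarith

lemma radial_lint {p : ℝ} (hp0 : 0 < p) (hp1 : p < 1) {G : ℂ → ℂ}
    (hG : DifferentiableOn ℂ G unitDisk) {R : ℝ} (hR : 1/2 ≤ R) (hR1 : R < 1) (t : ℝ) :
    ENNReal.ofReal (‖G (R * Complex.exp (Complex.I * t)) -
      G (((1/2 : ℝ) : ℂ) * Complex.exp (Complex.I * t))‖ ^ 2) ≤
    ENNReal.ofReal (2 / (1 - p)) * ∫⁻ s in Ioi (0:ℝ), ENNReal.ofReal s *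
      unitDisk.indicator (fun z => ENNReal.ofReal (‖deriv G z‖ ^ 2 * (1 - ‖z‖ ^ 2) ^ p))
        (s * Complex.exp (Complex.I * t)) := by
  set e := Complex.exp (Complex.I * t) with he
  have hq : 0 < 1 - p := by linarith
  have hne : ∀ s : ℝ, 0 ≤ s → ‖(s : ℂ) * e‖ = s := fun s hs => norm_rexp hs t
  have hen : ‖e‖ = 1 := by simpa using hne 1 zero_le_one
  have hmem : ∀ s ∈ Icc (1/2) R, (s : ℂ) * e ∈ unitDisk := fun s hs => by
    rw [mem_unitDisk, hne s (by linarith [hs.1])]; linarith [hs.2]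
  have hu : uIcc (1/2) R = Icc (1/2) R := uIcc_of_le hR
  have hcG : ContinuousOn (fun s : ℝ => deriv G (s * e)) (Icc (1/2) R) :=
    (hG.deriv isOpen_unitDisk).continuousOn.comp (by fun_prop) hmem
  have hd : ∀ s ∈ uIcc (1/2) R, HasDerivAt (fun s : ℝ => G (s * e)) (deriv G (s * e) * e) s := by
    intro s hs
    rw [hu] at hs
    have h1 := (hG.differentiableAt (isOpen_unitDisk.mem_nhds (hmem s hs))).hasDerivAt
    have h2 : HasDerivAt (fun s : ℂ => s * e) e (s : ℂ) := by simpa using (hasDerivAt_id (s : ℂ)).mul_const e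
    exact (h1.comp (s : ℂ) h2).comp_ofReal
  have hftc := intervalIntegral.integral_eq_sub_of_hasDerivAt hd
    (ContinuousOn.intervalIntegrable (by rw [hu]; fun_prop))
  have h1 : ‖G (R * e) - G (((1/2 : ℝ) : ℂ) * e)‖ ≤ ∫ s in (1/2:ℝ)..R, ‖deriv G (s * e)‖ := by
    rw [← hftc]
    refine (intervalIntegral.norm_integral_le_integral_norm hR).trans_eq ?_
    simp [hen]
  have h2 := cs_radial hp0 hp1 hR hR1 hcG.norm
  have h3 : ‖G (R * e) - G (((1/2 : ℝ) : ℂ) * e)‖ ^ 2 ≤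
      (1 / (1 - p)) * ∫ s in (1/2:ℝ)..R, ‖deriv G (s * e)‖ ^ 2 * (1 - s) ^ p :=
    le_trans (by gcongr) h2
  have hc1 : ContinuousOn (fun s : ℝ => (1 - s) ^ p) (Icc (1/2) R) :=
    ContinuousOn.rpow_const (by fun_prop) fun s hs => Or.inr hp0.le
  have h4 : ENNReal.ofReal (∫ s in (1/2:ℝ)..R, ‖deriv G (s * e)‖ ^ 2 * (1 - s) ^ p) =
      ∫⁻ s in Ioc (1/2) R, ENNReal.ofReal (‖deriv G (s * e)‖ ^ 2 * (1 - s) ^ p) := by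
    rw [intervalIntegral.integral_of_le hR, ofReal_integral_eq_lintegral_ofReal]
    · exact (ContinuousOn.intervalIntegrable (a := 1/2) (b := R)
        (by rw [hu]; exact (hcG.norm.pow 2).mul hc1)).1
    · filter_upwards [ae_restrict_mem measurableSet_Ioc] with s hs
      have : 0 ≤ 1 - s := by linarith [hs.2]
      simp only [Pi.zero_apply]
      positivity
  refine (ENNReal.ofReal_le_ofReal h3).trans ?_
  rw [ENNReal.ofReal_mul (by positivity), h4,
    show (2 / (1 - p) : ℝ) = (1 / (1 - p)) * 2 by ring, ENNReal.ofReal_mul (by positivity), mul_assoc]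
  gcongr
  rw [← lintegral_const_mul' _ _ (by simp)]
  refine le_trans (setLIntegral_mono' measurableSet_Ioc fun s hs => ?_)
    (lintegral_mono_set (s := Ioc (1/2) R) fun s hs => ?_)
  · have hs' : s ∈ Icc (1/2) R := ⟨hs.1.le, hs.2⟩
    have hs0 : 0 ≤ s := by linarith [hs.1]
    rw [indicator_of_mem (hmem s hs'), hne s hs0, ← ENNReal.ofReal_mul hs0,
      ← ENNReal.ofReal_mul (by norm_num)]
    apply ENNReal.ofReal_le_ofReal
    have a1 : (1 - s) ^ p ≤ (1 - s ^ 2) ^ p := by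
      apply Real.rpow_le_rpow (by linarith [hs.2]) _ hp0.le
      nlinarith [hs.2]
    have a0 : 0 ≤ (1 - s ^ 2) ^ p := Real.rpow_nonneg (by nlinarith [hs.2]) _
    have a2 : ‖deriv G (s * e)‖ ^ 2 * (1 - s) ^ p ≤ ‖deriv G (s * e)‖ ^ 2 * (1 - s ^ 2) ^ p := by gcongr
    have a3 : 0 ≤ ‖deriv G (s * e)‖ ^ 2 * (1 - s ^ 2) ^ p := by positivity
    nlinarith [hs.1]
  · have := hs.1
    simp only [mem_Ioi]; linarith

lemma per_circ (φ : ℂ → ℝ) (r : ℝ) :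
    Function.Periodic (fun t : ℝ => φ ((r : ℂ) * Complex.exp (Complex.I * t))) (2 * π) := by
  intro t
  simp only
  rw [exp_per]

/-- `H²`-estimate of a function by its Dirichlet-type integral. -/
lemma h2_of_qp {p : ℝ} (hp0 : 0 < p) (hp1 : p < 1) {G : ℂ → ℂ}
    (hG : DifferentiableOn ℂ G unitDisk) {C : ℝ} (hC : 0 ≤ C)
    (hq : qpIntegral p G 0 ≤ ENNReal.ofReal C) {r : ℝ} (hr : r ∈ Ico (0:ℝ) 1) :
    ∫ t in (0:ℝ)..(2 * π), ‖G ((r : ℂ) * Complex.exp (Complex.I * t)) - G 0‖ ^ 2 ≤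
      (4 / (1 - p) + 100 * π) * C := by
  have hpp : 0 < 1 - p := by linarith
  have hcont : Continuous fun t : ℝ => ‖G ((r : ℂ) * Complex.exp (Complex.I * t)) - G 0‖ ^ 2 := by
    have h := circ_cont (c := 0) (δ := 1) (r := r) hG.continuousOn hr.1 hr.2
    simp only [zero_add] at h
    exact (h.sub continuous_const).norm.pow 2
  have hlin : ∫⁻ t in Ioo (-π) π, ENNReal.ofReal (‖G ((r : ℂ) * Complex.exp (Complex.I * t)) - G 0‖ ^ 2) ≤
      ENNReal.ofReal ((4 / (1 - p) + 100 * π) * C) := by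
    set J : ℝ → ℝ≥0∞ := fun t => ∫⁻ s in Ioi (0:ℝ), ENNReal.ofReal s *
      unitDisk.indicator (fun z => ENNReal.ofReal (‖deriv G z‖ ^ 2 * (1 - ‖z‖ ^ 2) ^ p))
        (s * Complex.exp (Complex.I * t)) with hJ
    have hJi : ∫⁻ t in Ioo (-π) π, J t ≤ ENNReal.ofReal C := by
      refine le_trans (le_of_eq ?_) hq
      have hm : Measurable (deriv G) := measurable_deriv G
      rw [qp0, ← lintegral_indicator isOpen_unitDisk.measurableSet, polar_lint]
      exact Measurable.indicator (by fun_prop) isOpen_unitDisk.measurableSet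
    calc _ ≤ ∫⁻ t in Ioo (-π) π, (ENNReal.ofReal (4 / (1 - p)) * J t + ENNReal.ofReal (50 * C)) := by
          refine lintegral_mono fun t => ?_
          rcases le_total r (1/2) with h | h
          · refine le_trans ?_ le_add_self
            apply ENNReal.ofReal_le_ofReal
            have := near_zero hp0 hp1 hG hC hq (w := (r : ℂ) * Complex.exp (Complex.I * t))
              (by rw [norm_rexp hr.1]; exact h)
            linarith
          · have h1 := radial_lint hp0 hp1 hG h hr.2 t
            have h2 := near_zero hp0 hp1 hG hC hq (w := ((1/2:ℝ) : ℂ) * Complex.exp (Complex.I * t))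
              (by rw [norm_rexp (by norm_num)])
            set x := G ((r : ℂ) * Complex.exp (Complex.I * t))
            set y := G (((1/2:ℝ) : ℂ) * Complex.exp (Complex.I * t))
            have h3 : ‖x - G 0‖ ^ 2 ≤ 2 * ‖x - y‖ ^ 2 + 50 * C := by
              have := norm_sub_le_norm_sub_add_norm_sub x y (G 0)
              nlinarith [norm_nonneg (x - G 0), sq_nonneg (‖x - y‖ - ‖y - G 0‖), norm_nonneg (x - y), norm_nonneg (y - G 0)]
            refine (ENNReal.ofReal_le_ofReal h3).trans ?_
            rw [ENNReal.ofReal_add (by positivity) (by positivity),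
              ENNReal.ofReal_mul (p := 2) (q := ‖x - y‖ ^ 2) (by norm_num),
              show (4 / (1 - p) : ℝ) = 2 * (2 / (1 - p)) by ring,
              ENNReal.ofReal_mul (p := 2) (q := 2 / (1 - p)) (by norm_num), mul_assoc]
            gcongr
      _ = ENNReal.ofReal (4 / (1 - p)) * (∫⁻ t in Ioo (-π) π, J t) + ENNReal.ofReal (50 * C) * ENNReal.ofReal (2 * π) := by
          rw [lintegral_add_right _ measurable_const, lintegral_const_mul' _ _ (by simp), setLIntegral_const,
            Real.volume_Ioo]
          congr 3; ring
      _ ≤ ENNReal.ofReal (4 / (1 - p)) * ENNReal.ofReal C + ENNReal.ofReal (50 * C) * ENNReal.ofReal (2 * π) := by gcongr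
      _ = _ := by
          have := Real.pi_pos
          rw [← ENNReal.ofReal_mul (by positivity), ← ENNReal.ofReal_mul (by positivity),
            ← ENNReal.ofReal_add (by positivity) (by positivity)]
          congr 1; ring
  have hp := Real.pi_pos
  rw [circ_lint hcont (fun t => by positivity) (per_circ (fun z => ‖G z - G 0‖ ^ 2) r),
    ENNReal.ofReal_le_ofReal_iff (by positivity)] at hlin
  exact hlin

/-- Finiteness of the integral at the origin gives the `H²` bound. -/
lemma h2Bounded_of_qp {p : ℝ} (hp0 : 0 < p) (hp1 : p < 1) {G : ℂ → ℂ}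
    (hG : DifferentiableOn ℂ G unitDisk) (h0 : G 0 = 0) {C : ℝ}
    (hq : qpIntegral p G 0 ≤ ENNReal.ofReal C) : h2Bounded G := by
  refine ⟨(4 / (1 - p) + 100 * π) * max C 0, fun r hr => ?_⟩
  have := h2_of_qp hp0 hp1 hG (le_max_right C 0)
    (hq.trans (ENNReal.ofReal_le_ofReal (le_max_left C 0))) hr
  simpa [h0] using this

lemma mb_bounds {a z ζ : ℂ} (ha : ‖a‖ < 1) (hz : ‖z‖ < 1) (hζ : ‖ζ‖ = 1) :
    (1 - ‖moebius a z‖ ^ 2) * ‖ζ - a‖ ≤ 16 * ‖ζ - z‖ ∧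
    (1 - ‖moebius a z‖ ^ 2) * ‖ζ - z‖ ≤ 16 * ‖ζ - a‖ := by
  have hd := den_ne ha hz.le
  have hx := one_sub_moebius hd
  have hx1 : 1 - ‖moebius a z‖ ^ 2 ≤ 1 := by nlinarith [sq_nonneg ‖moebius a z‖]
  have hsq := norm_den_sq a z
  have ha1 := norm_sub_norm_le ζ a
  have hz1 := norm_sub_norm_le ζ z
  rw [hζ] at ha1 hz1
  have t1 : ‖ζ - a‖ ≤ ‖ζ - z‖ + ‖a - z‖ := by
    have := norm_sub_le_norm_sub_add_norm_sub ζ z a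
    rwa [norm_sub_rev z a] at this
  have t2 : ‖ζ - z‖ ≤ ‖ζ - a‖ + ‖a - z‖ := norm_sub_le_norm_sub_add_norm_sub ζ a z
  have hD : 0 < ‖1 - (starRingEnd ℂ) a * z‖ ^ 2 := by
    have := norm_pos_iff.mpr hd
    positivity
  have hxD : (1 - ‖moebius a z‖ ^ 2) * ‖1 - (starRingEnd ℂ) a * z‖ ^ 2 = (1 - ‖a‖ ^ 2) * (1 - ‖z‖ ^ 2) := by
    rw [hx]; field_simp
  have hx0 : 0 ≤ 1 - ‖moebius a z‖ ^ 2 := by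
    have := mem_unitDisk.mp (moebius_mem (mem_unitDisk.mpr ha) (mem_unitDisk.mpr hz))
    nlinarith [norm_nonneg (moebius a z)]
  have na := norm_nonneg a
  have nz := norm_nonneg z
  have b1 : 1 - ‖a‖ ^ 2 ≤ 2 * ‖ζ - a‖ := by nlinarith
  have b2 : 1 - ‖z‖ ^ 2 ≤ 2 * ‖ζ - z‖ := by nlinarith
  have b1' : 0 < 1 - ‖a‖ ^ 2 := by nlinarith
  have b2' : 0 < 1 - ‖z‖ ^ 2 := by nlinarith
  have hprod : (1 - ‖a‖ ^ 2) * (1 - ‖z‖ ^ 2) ≤ 4 * ‖ζ - a‖ * ‖ζ - z‖ := by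
    calc _ ≤ (2 * ‖ζ - a‖) * (2 * ‖ζ - z‖) := by gcongr
      _ = _ := by ring
  have hdist : ‖a - z‖ ^ 2 ≤ ‖1 - (starRingEnd ℂ) a * z‖ ^ 2 := by
    have : 0 < (1 - ‖a‖ ^ 2) * (1 - ‖z‖ ^ 2) := by positivity
    linarith
  have hfin : (1 - ‖moebius a z‖ ^ 2) * ‖a - z‖ ^ 2 ≤ 4 * ‖ζ - a‖ * ‖ζ - z‖ := by
    calc _ ≤ (1 - ‖moebius a z‖ ^ 2) * ‖1 - (starRingEnd ℂ) a * z‖ ^ 2 := by gcongr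
      _ ≤ _ := by rw [hxD]; exact hprod
  have hs : 0 < ‖ζ - a‖ := by linarith
  have hr : 0 < ‖ζ - z‖ := by linarith
  generalize 1 - ‖moebius a z‖ ^ 2 = x at *
  generalize ‖ζ - a‖ = s at *
  generalize ‖ζ - z‖ = r at *
  generalize ‖a - z‖ = d at *
  constructor
  · by_cases h : s ≤ 2 * r
    · nlinarith
    · push Not at h
      have h1 : s / 2 ≤ d := by linarith
      have h2 : (s/2) ^ 2 ≤ d ^ 2 := by gcongr
      have h3 : x * (s/2)^2 ≤ 4 * s * r := le_trans (by gcongr) hfin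
      have h4 : s * (x * s) ≤ s * (16 * r) := by nlinarith
      exact le_of_mul_le_mul_left h4 hs
  · by_cases h : r ≤ 2 * s
    · nlinarith
    · push Not at h
      have h1 : r / 2 ≤ d := by linarith
      have h2 : (r/2) ^ 2 ≤ d ^ 2 := by gcongr
      have h3 : x * (r/2)^2 ≤ 4 * s * r := le_trans (by gcongr) hfin
      have h4 : r * (x * r) ≤ r * (16 * s) := by nlinarith
      exact le_of_mul_le_mul_left h4 hr

/-- the radial majorant -/
def majorant (p s r : ℝ) : ℝ :=
  if r ≤ s then (16 / s) ^ p * r ^ (p - 2) else (16 * s) ^ p * r ^ (-p - 2)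

lemma majorant_meas (p s : ℝ) : Measurable (majorant p s) := by
  unfold majorant
  exact Measurable.ite measurableSet_Iic (by fun_prop) (by fun_prop)

lemma majorant_int {p s : ℝ} (hp0 : 0 < p) (hs : 0 < s) :
    ∫⁻ r in Ioi (0:ℝ), ENNReal.ofReal (r * majorant p s r) ≤ ENNReal.ofReal (2 * 16 ^ p / p) := by
  rw [← Ioc_union_Ioi_eq_Ioi hs.le, lintegral_union measurableSet_Ioi
    (Set.disjoint_left.mpr fun x hx hy => absurd hx.2 (not_le.mpr hy))]
  have h1 : ∫⁻ r in Ioc 0 s, ENNReal.ofReal (r * majorant p s r) = ENNReal.ofReal (16 ^ p / p) := by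
    have e1 : ∫⁻ r in Ioc 0 s, ENNReal.ofReal (r * majorant p s r) =
        ∫⁻ r in Ioc 0 s, ENNReal.ofReal ((16 / s) ^ p * r ^ (p - 1)) := by
      refine setLIntegral_congr_fun measurableSet_Ioc fun r hr => ?_
      simp only [majorant, if_pos hr.2]
      congr 1
      rw [show p - 1 = (p - 2) + 1 by ring, Real.rpow_add_one hr.1.ne']
      ring
    have hint : IntervalIntegrable (fun r : ℝ => (16 / s) ^ p * r ^ (p - 1)) volume 0 s :=
      (intervalIntegral.intervalIntegrable_rpow' (by linarith)).const_mul _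
    rw [e1, ← ofReal_integral_eq_lintegral_ofReal hint.1, ← intervalIntegral.integral_of_le hs.le,
      intervalIntegral.integral_const_mul, integral_rpow (Or.inl (by linarith))]
    · congr 1
      rw [Real.div_rpow (by norm_num) hs.le, sub_add_cancel, Real.zero_rpow hp0.ne']
      have := Real.rpow_pos_of_pos hs p
      field_simp
      ring
    · filter_upwards [ae_restrict_mem measurableSet_Ioc] with r hr
      have := hr.1
      simp only [Pi.zero_apply]
      positivity
  have h2 : ∫⁻ r in Ioi s, ENNReal.ofReal (r * majorant p s r) = ENNReal.ofReal (16 ^ p / p) := by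
    have e1 : ∫⁻ r in Ioi s, ENNReal.ofReal (r * majorant p s r) =
        ∫⁻ r in Ioi s, ENNReal.ofReal ((16 * s) ^ p * r ^ (-p - 1)) := by
      refine setLIntegral_congr_fun measurableSet_Ioi fun r hr => ?_
      have hr0 : 0 < r := hs.trans hr
      simp only [majorant, if_neg (not_le.mpr (mem_Ioi.mp hr))]
      congr 1
      rw [show -p - 1 = (-p - 2) + 1 by ring, Real.rpow_add_one hr0.ne']
      ring
    have hint : IntegrableOn (fun r : ℝ => (16 * s) ^ p * r ^ (-p - 1)) (Ioi s) :=
      (integrableOn_Ioi_rpow_of_lt (by linarith) hs).const_mul _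
    rw [e1, ← ofReal_integral_eq_lintegral_ofReal hint, integral_const_mul,
      integral_Ioi_rpow_of_lt (by linarith) hs]
    · congr 1
      rw [Real.mul_rpow (by norm_num) hs.le, sub_add_cancel, Real.rpow_neg hs.le]
      have := Real.rpow_pos_of_pos hs p
      field_simp
    · filter_upwards [ae_restrict_mem measurableSet_Ioi] with r hr
      have : 0 < r := hs.trans hr
      simp only [Pi.zero_apply]
      positivity
  rw [h1, h2, ← ENNReal.ofReal_add (by positivity) (by positivity)]
  apply ENNReal.ofReal_le_ofReal
  apply le_of_eq; ring

lemma majorant_plane {p s : ℝ} (hp0 : 0 < p) (hs : 0 < s) :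
    ∫⁻ u : ℂ, ENNReal.ofReal (majorant p s ‖u‖) ≤ ENNReal.ofReal (2 * 16 ^ p / p * (2 * π)) := by
  rw [polar_lint2 _ (by have := majorant_meas p s; fun_prop)]
  calc _ = ∫⁻ r in Ioi (0:ℝ), ENNReal.ofReal (r * majorant p s r) * ENNReal.ofReal (2 * π) := by
        refine setLIntegral_congr_fun measurableSet_Ioi fun r hr => ?_
        have hr0 : (0:ℝ) ≤ r := le_of_lt hr
        simp only [norm_rexp hr0]
        rw [setLIntegral_const, Real.volume_Ioo, ← ENNReal.ofReal_mul hr0]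
        congr 2; ring
    _ = (∫⁻ r in Ioi (0:ℝ), ENNReal.ofReal (r * majorant p s r)) * ENNReal.ofReal (2 * π) :=
        lintegral_mul_const' _ _ ENNReal.ofReal_ne_top
    _ ≤ _ := by
        rw [ENNReal.ofReal_mul (p := 2 * 16 ^ p / p) (q := 2 * π) (by positivity)]
        gcongr
        exact majorant_int hp0 hs

lemma log_arg {ζ z : ℂ} (hζ : ‖ζ‖ = 1) (hz : z ∈ unitDisk) :
    1 - (starRingEnd ℂ) ζ * z ∈ slitPlane := by
  refine Or.inl ?_
  have h1 : ((starRingEnd ℂ) ζ * z).re ≤ ‖(starRingEnd ℂ) ζ * z‖ := Complex.re_le_norm _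
  rw [norm_mul, RCLike.norm_conj, hζ, one_mul] at h1
  rw [mem_unitDisk] at hz
  rw [Complex.sub_re, Complex.one_re]
  linarith

lemma norm_log_arg {ζ : ℂ} (hζ : ‖ζ‖ = 1) (z : ℂ) :
    ‖1 - (starRingEnd ℂ) ζ * z‖ = ‖ζ - z‖ := by
  have h1 : (starRingEnd ℂ) ζ * ζ = 1 := by
    rw [Complex.conj_mul', hζ]; simp
  have : 1 - (starRingEnd ℂ) ζ * z = (starRingEnd ℂ) ζ * (ζ - z) := by
    rw [mul_sub, h1]
  rw [this, norm_mul, RCLike.norm_conj, hζ, one_mul]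

lemma log_mem {p : ℝ} (hp0 : 0 < p) (hp1 : p < 1) {ζ : ℂ} (hζ : ‖ζ‖ = 1) :
    MemQp p (fun z => Complex.log (1 - (starRingEnd ℂ) ζ * z)) := by
  have hder : ∀ z ∈ unitDisk, HasDerivAt (fun z => Complex.log (1 - (starRingEnd ℂ) ζ * z))
      (-(starRingEnd ℂ) ζ / (1 - (starRingEnd ℂ) ζ * z)) z := by
    intro z hz
    have h1 : HasDerivAt (fun z => 1 - (starRingEnd ℂ) ζ * z) (-(starRingEnd ℂ) ζ) z := by
      simpa using ((hasDerivAt_id z).const_mul ((starRingEnd ℂ) ζ)).const_sub 1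
    exact h1.clog (log_arg hζ hz)
  have hdiff : DifferentiableOn ℂ (fun z => Complex.log (1 - (starRingEnd ℂ) ζ * z)) unitDisk :=
    fun z hz => (hder z hz).differentiableAt.differentiableWithinAt
  have hq : ∀ a ∈ unitDisk, qpIntegral p (fun z => Complex.log (1 - (starRingEnd ℂ) ζ * z)) a ≤
      ENNReal.ofReal (2 * 16 ^ p / p * (2 * π)) := by
    intro a ha
    have ha' := mem_unitDisk.mp ha
    have hs : 0 < ‖ζ - a‖ := by
      have := norm_sub_norm_le ζ a
      rw [hζ] at this; linarith
    refine le_trans ?_ (majorant_plane hp0 hs)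
    rw [← lintegral_sub_left_eq_self _ ζ, qpIntegral]
    refine le_trans (setLIntegral_mono' isOpen_unitDisk.measurableSet fun z hz => ?_)
      (setLIntegral_le_lintegral unitDisk _)
    apply ENNReal.ofReal_le_ofReal
    have hz' := mem_unitDisk.mp hz
    have hr : 0 < ‖ζ - z‖ := by
      have := norm_sub_norm_le ζ z
      rw [hζ] at this; linarith
    rw [(hder z hz).deriv, norm_div, norm_neg, RCLike.norm_conj, hζ, norm_log_arg hζ]
    obtain ⟨m1, m2⟩ := mb_bounds ha' hz' hζ
    have hx0 : 0 ≤ 1 - ‖moebius a z‖ ^ 2 := by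
      have := mem_unitDisk.mp (moebius_mem ha hz)
      nlinarith [norm_nonneg (moebius a z)]
    generalize 1 - ‖moebius a z‖ ^ 2 = x at *
    generalize ‖ζ - a‖ = s at *
    generalize ‖ζ - z‖ = r at *
    have e2 : (1 / r) ^ 2 = r ^ (-2 : ℝ) := by
      rw [Real.rpow_neg hr.le, Real.rpow_two]; simp
    rw [e2, majorant]
    split_ifs
    · have : x ≤ (16 / s) * r := by
        rw [div_mul_eq_mul_div, le_div_iff₀ hs]; exact m1
      calc r ^ (-2:ℝ) * x ^ p ≤ r ^ (-2:ℝ) * ((16 / s) * r) ^ p := by gcongr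
        _ = _ := by
          rw [Real.mul_rpow (by positivity) hr.le, show p - 2 = -2 + p by ring, Real.rpow_add hr]
          ring
    · have : x ≤ (16 * s) * r⁻¹ := by
        rw [← div_eq_mul_inv, le_div_iff₀ hr]; exact m2
      calc r ^ (-2:ℝ) * x ^ p ≤ r ^ (-2:ℝ) * ((16 * s) * r⁻¹) ^ p := by gcongr
        _ = _ := by
          rw [Real.mul_rpow (by positivity) (by positivity), show -p - 2 = -2 + -p by ring, Real.rpow_add hr,
            Real.inv_rpow hr.le, Real.rpow_neg hr.le p]
          ring
  exact ⟨hdiff, h2Bounded_of_qp hp0 hp1 hdiff (by simp) (hq 0 (by simp [unitDisk])), _, hq⟩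

lemma disk_sq {f : ℂ → ℂ} (hf : DifferentiableOn ℂ f unitDisk) (h2 : h2Bounded f) :
    ∃ C : ℝ, 0 ≤ C ∧ ∫⁻ z in unitDisk, ENNReal.ofReal (‖f z‖ ^ 2) ≤ ENNReal.ofReal C := by
  obtain ⟨M, hM⟩ := h2
  have hM0 : 0 ≤ max M 0 := le_max_right _ _
  refine ⟨max M 0, hM0, ?_⟩
  have hmeas : Measurable (unitDisk.indicator fun z => ENNReal.ofReal (‖f z‖ ^ 2)) := by
    classical
    have hc : ContinuousOn (fun z => ENNReal.ofReal (‖f z‖ ^ 2)) unitDisk :=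
      ENNReal.continuous_ofReal.comp_continuousOn (hf.continuousOn.norm.pow 2)
    have := hc.measurable_piecewise (g := fun _ => (0:ℝ≥0∞)) continuousOn_const isOpen_unitDisk.measurableSet
    convert this using 1
    ext z
    simp [indicator, piecewise]
  rw [← lintegral_indicator isOpen_unitDisk.measurableSet, polar_lint2 _ hmeas]
  calc _ ≤ ∫⁻ r in Ioi (0:ℝ), (Ioo (0:ℝ) 1).indicator (fun _ => ENNReal.ofReal (max M 0)) r := by
        refine setLIntegral_mono' measurableSet_Ioi fun r hr => ?_
        have hr0 : (0:ℝ) ≤ r := le_of_lt hr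
        by_cases h : r < 1
        · rw [indicator_of_mem (show r ∈ Ioo (0:ℝ) 1 from ⟨hr, h⟩)]
          have hcont : Continuous fun t : ℝ => ‖f ((r : ℂ) * Complex.exp (Complex.I * t))‖ ^ 2 := by
            have h := circ_cont (c := 0) (δ := 1) (r := r) hf.continuousOn hr0 h
            simp only [zero_add] at h
            exact h.norm.pow 2
          calc _ ≤ ∫⁻ t in Ioo (-π) π, ENNReal.ofReal (‖f ((r : ℂ) * Complex.exp (Complex.I * t))‖ ^ 2) := by
                refine lintegral_mono fun t => ?_
                rw [indicator_of_mem (by rw [mem_unitDisk, norm_rexp hr0]; exact h)]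
                calc _ ≤ 1 * ENNReal.ofReal (‖f ((r : ℂ) * Complex.exp (Complex.I * t))‖ ^ 2) := by
                      gcongr
                      exact ENNReal.ofReal_le_one.mpr h.le
                  _ = _ := one_mul _
            _ ≤ _ := by
                rw [circ_lint hcont (fun t => by positivity) (per_circ (fun z => ‖f z‖ ^ 2) r)]
                apply ENNReal.ofReal_le_ofReal
                exact (hM r ⟨hr0, h⟩).trans (le_max_left _ _)
        · refine le_trans (le_of_eq ?_) zero_le
          have : ∀ t : ℝ, unitDisk.indicator (fun z => ENNReal.ofReal (‖f z‖ ^ 2))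
              ((r : ℂ) * Complex.exp (Complex.I * t)) = 0 := fun t => by
            rw [indicator_of_notMem]
            rw [mem_unitDisk, norm_rexp hr0]; exact h
          simp only [this, mul_zero, lintegral_zero]
    _ ≤ ∫⁻ r, (Ioo (0:ℝ) 1).indicator (fun _ => ENNReal.ofReal (max M 0)) r :=
        setLIntegral_le_lintegral _ _
    _ = _ := by
        rw [lintegral_indicator measurableSet_Ioo, setLIntegral_const, Real.volume_Ioo]
        simp

lemma memQp_mul {p : ℝ} (hp0 : 0 < p) {g f : ℂ → ℂ} (hg : DifferentiableOn ℂ g unitDisk)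
    {M K : ℝ} (hM : ∀ z ∈ unitDisk, ‖g z‖ ≤ M) (hK : ∀ z ∈ unitDisk, ‖deriv g z‖ ≤ K)
    (hf : MemQp p f) : MemQp p (fun z => g z * f z) := by
  obtain ⟨hd, h2, C, hC⟩ := hf
  have h0mem : (0:ℂ) ∈ unitDisk := by simp [unitDisk]
  have hM0 : 0 ≤ M := (norm_nonneg _).trans (hM 0 h0mem)
  have hK0 : 0 ≤ K := (norm_nonneg _).trans (hK 0 h0mem)
  obtain ⟨C2, hC20, hC2⟩ := disk_sq hd h2
  refine ⟨hg.mul hd, ?_, 2 * K ^ 2 * C2 + 2 * M ^ 2 * max C 0, fun a ha => ?_⟩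
  · obtain ⟨A, hA⟩ := h2
    refine ⟨M ^ 2 * A, fun r hr => ?_⟩
    have hcf := circ_cont (c := 0) (δ := 1) (r := r) hd.continuousOn hr.1 hr.2
    have hcg := circ_cont (c := 0) (δ := 1) (r := r) hg.continuousOn hr.1 hr.2
    simp only [zero_add] at hcf hcg
    calc _ ≤ ∫ t in (0:ℝ)..(2 * π), M ^ 2 * ‖f ((r : ℂ) * Complex.exp (Complex.I * t))‖ ^ 2 := by
          apply intervalIntegral.integral_mono_on (by positivity)
          · exact ((hcg.mul hcf).norm.pow 2).intervalIntegrable _ _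
          · exact ((hcf.norm.pow 2).const_mul _).intervalIntegrable _ _
          · intro t _
            rw [norm_mul, mul_pow]
            gcongr
            exact hM _ (by rw [mem_unitDisk, norm_rexp hr.1]; exact hr.2)
      _ ≤ _ := by
          rw [intervalIntegral.integral_const_mul]
          gcongr
          exact hA r hr
  · have hmeas : Measurable (deriv f) := measurable_deriv f
    have hmm : Measurable (moebius a) := by unfold moebius; fun_prop
    calc qpIntegral p (fun z => g z * f z) a
        ≤ ∫⁻ z in unitDisk, (ENNReal.ofReal (2 * K ^ 2) * ENNReal.ofReal (‖f z‖ ^ 2) +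
          ENNReal.ofReal (2 * M ^ 2) * ENNReal.ofReal (‖deriv f z‖ ^ 2 * (1 - ‖moebius a z‖ ^ 2) ^ p)) := by
          refine setLIntegral_mono' isOpen_unitDisk.measurableSet fun z hz => ?_
          have hm := mem_unitDisk.mp (moebius_mem ha hz)
          have hx0 : 0 ≤ 1 - ‖moebius a z‖ ^ 2 := by nlinarith [norm_nonneg (moebius a z)]
          have hx1 : (1 - ‖moebius a z‖ ^ 2) ^ p ≤ 1 :=
            Real.rpow_le_one hx0 (by nlinarith [norm_nonneg (moebius a z)]) hp0.le
          have hxp : 0 ≤ (1 - ‖moebius a z‖ ^ 2) ^ p := Real.rpow_nonneg hx0 _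
          rw [← ENNReal.ofReal_mul (by positivity), ← ENNReal.ofReal_mul (by positivity),
            ← ENNReal.ofReal_add (by positivity) (by positivity)]
          apply ENNReal.ofReal_le_ofReal
          have hnh := isOpen_unitDisk.mem_nhds hz
          rw [deriv_fun_mul (hg.differentiableAt hnh) (hd.differentiableAt hnh)]
          have t := norm_add_le (deriv g z * f z) (g z * deriv f z)
          rw [norm_mul, norm_mul] at t
          have t1 : ‖deriv g z‖ * ‖f z‖ ≤ K * ‖f z‖ := by gcongr; exact hK z hz
          have t2 : ‖g z‖ * ‖deriv f z‖ ≤ M * ‖deriv f z‖ := by gcongr; exact hM z hz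
          have t3 : ‖deriv g z * f z + g z * deriv f z‖ ≤ K * ‖f z‖ + M * ‖deriv f z‖ := by linarith
          generalize (1 - ‖moebius a z‖ ^ 2) ^ p = x at *
          have t4 : ‖deriv g z * f z + g z * deriv f z‖ ^ 2 ≤ 2 * (K * ‖f z‖) ^ 2 + 2 * (M * ‖deriv f z‖) ^ 2 := by
            calc _ ≤ (K * ‖f z‖ + M * ‖deriv f z‖) ^ 2 := by gcongr
              _ ≤ _ := by nlinarith [sq_nonneg (K * ‖f z‖ - M * ‖deriv f z‖)]
          calc _ ≤ (2 * (K * ‖f z‖) ^ 2 + 2 * (M * ‖deriv f z‖) ^ 2) * x := by gcongr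
            _ = 2 * (K * ‖f z‖) ^ 2 * x + 2 * M ^ 2 * (‖deriv f z‖ ^ 2 * x) := by ring
            _ ≤ 2 * (K * ‖f z‖) ^ 2 * 1 + 2 * M ^ 2 * (‖deriv f z‖ ^ 2 * x) := by gcongr
            _ = _ := by ring
      _ = ENNReal.ofReal (2 * K ^ 2) * (∫⁻ z in unitDisk, ENNReal.ofReal (‖f z‖ ^ 2)) +
          ENNReal.ofReal (2 * M ^ 2) * qpIntegral p f a := by
          rw [lintegral_add_right _ (by fun_prop), lintegral_const_mul' _ _ ENNReal.ofReal_ne_top,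
            lintegral_const_mul' _ _ ENNReal.ofReal_ne_top, qpIntegral]
      _ ≤ ENNReal.ofReal (2 * K ^ 2) * ENNReal.ofReal C2 +
          ENNReal.ofReal (2 * M ^ 2) * ENNReal.ofReal (max C 0) := by
          gcongr
          exact (hC a ha).trans (ENNReal.ofReal_le_ofReal (le_max_left _ _))
      _ = _ := by
          have := le_max_right C 0
          rw [← ENNReal.ofReal_mul (by positivity), ← ENNReal.ofReal_mul (by positivity),
            ← ENNReal.ofReal_add (by positivity) (by positivity)]

lemma one_memQp (p : ℝ) : MemQp p (fun _ => (1:ℂ)) := by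
  refine ⟨differentiableOn_const _, ⟨2 * π, fun r _ => by simp⟩, 0, fun a _ => ?_⟩
  simp [qpIntegral]

lemma memMQp_of_analytic {p : ℝ} (hp0 : 0 < p) {g : ℂ → ℂ}
    (hg : AnalyticOnNhd ℂ g (closedBall 0 1)) : MemMQp p g := by
  obtain ⟨M, hM⟩ := (isCompact_closedBall (0:ℂ) 1).exists_bound_of_continuousOn hg.continuousOn
  obtain ⟨K, hK⟩ := (isCompact_closedBall (0:ℂ) 1).exists_bound_of_continuousOn hg.deriv.continuousOn
  have hsub : unitDisk ⊆ closedBall 0 1 := ball_subset_closedBall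
  have hd := hg.differentiableOn.mono hsub
  have key : ∀ f, MemQp p f → MemQp p (fun z => g z * f z) := fun f hf =>
    memQp_mul hp0 hd (fun z hz => hM z (hsub hz)) (fun z hz => hK z (hsub hz)) hf
  exact ⟨by simpa using key _ (one_memQp p), key⟩

lemma finite_case {p : ℝ} (hp0 : 0 < p) {ι : Type*} [Finite ι] (m : ℕ) (a : ι → ℂ)
    (ha : ∀ k, a k ∈ unitDisk ∧ a k ≠ 0) : MemMQp p (blaschkeProduct m a) := by
  have := Fintype.ofFinite ι
  apply memMQp_of_analytic hp0
  intro z hz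
  have : blaschkeProduct m a = fun z => z ^ m * ∏ k, ((‖a k‖ : ℂ) / a k) * ((a k - z) / (1 - (starRingEnd ℂ) (a k) * z)) := by
    ext z
    rw [blaschkeProduct, tprod_fintype]
  rw [this]
  refine (analyticAt_id.pow m).mul ?_
  apply Finset.analyticAt_fun_prod
  intro k _
  refine analyticAt_const.mul (AnalyticAt.div (by fun_prop) (by fun_prop) ?_)
  exact den_ne (mem_unitDisk.mp (ha k).1) (by simpa using hz)

def bfac (a z : ℂ) : ℂ := ((‖a‖ : ℂ) / a) * ((a - z) / (1 - (starRingEnd ℂ) a * z))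

lemma bfac_norm {a : ℂ} (ha0 : a ≠ 0) (z : ℂ) : ‖bfac a z‖ = ‖moebius a z‖ := by
  have : ‖a‖ ≠ 0 := by simpa using ha0
  rw [bfac, moebius, norm_mul, norm_div, Complex.norm_real, norm_norm, div_self this, one_mul]

lemma bfac_self (a : ℂ) : bfac a a = 0 := by simp [bfac]

lemma bfac_bound {a z : ℂ} {ρ : ℝ} (ha : ‖a‖ < 1) (ha0 : a ≠ 0) (hρ : ρ < 1) (hz : ‖z‖ ≤ ρ) :
    ‖bfac a z - 1‖ ≤ 2 / (1 - ρ) * (1 - ‖a‖) := by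
  have hd := den_ne ha (hz.trans hρ.le)
  have hn : 0 < ‖a‖ := norm_pos_iff.mpr ha0
  have hsq : a * (starRingEnd ℂ) a = (‖a‖ : ℂ) ^ 2 := by rw [Complex.mul_conj']
  have e : bfac a z - 1 = -((1 - (‖a‖:ℂ)) * (a + ‖a‖ * z)) / (a * (1 - (starRingEnd ℂ) a * z)) := by
    rw [bfac, div_mul_div_comm, div_sub_one (mul_ne_zero ha0 hd)]
    congr 1
    linear_combination z * hsq
  have h1 : 1 - ρ ≤ ‖1 - (starRingEnd ℂ) a * z‖ := by
    have := norm_sub_norm_le (1:ℂ) ((starRingEnd ℂ) a * z)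
    rw [norm_one, norm_mul, RCLike.norm_conj] at this
    have : ‖a‖ * ‖z‖ ≤ 1 * ρ := by gcongr
    linarith
  have h2 : ‖a + ‖a‖ * z‖ ≤ 2 * ‖a‖ := by
    refine (norm_add_le _ _).trans ?_
    rw [norm_mul, Complex.norm_real, norm_norm]
    nlinarith
  have h3 : ‖1 - (‖a‖:ℂ)‖ = 1 - ‖a‖ := by
    rw [← Complex.ofReal_one, ← Complex.ofReal_sub, Complex.norm_real, Real.norm_of_nonneg (by linarith)]
  have hρ' : 0 < 1 - ρ := by linarith
  rw [e, norm_div, norm_neg, norm_mul, norm_mul, h3]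
  calc _ ≤ (1 - ‖a‖) * (2 * ‖a‖) / (‖a‖ * (1 - ρ)) := by
        have : 0 ≤ 1 - ‖a‖ := by linarith
        gcongr
    _ = _ := by field_simp

lemma bfac_diff {a : ℂ} (ha : ‖a‖ < 1) : DifferentiableOn ℂ (bfac a) unitDisk := by
  intro z hz
  exact ((moebius_diffAt ha (mem_unitDisk.mp hz).le).const_mul ((‖a‖:ℂ)/a)).differentiableWithinAt

lemma tail_exists {ι : Type*} (a : ι → ℂ) (ha : ∀ k, a k ∈ unitDisk ∧ a k ≠ 0)
    (hb : Summable fun k => 1 - ‖a k‖) {w : ℂ} (hw : w ∈ unitDisk) :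
    ∃ (S : Finset ι) (T : ℂ → ℂ), DifferentiableOn ℂ T unitDisk ∧ 1 / 2 ≤ ‖T w‖ ∧
      ∀ z ∈ unitDisk, ∏' k, bfac (a k) z = (∏ k ∈ S, bfac (a k) z) * T z := by
  classical
  have ha' : ∀ k, ‖a k‖ < 1 := fun k => mem_unitDisk.mp (ha k).1
  have hsum : ∀ z ∈ unitDisk, Summable fun k => ‖bfac (a k) z - 1‖ := fun z hz =>
    Summable.of_nonneg_of_le (fun _ => norm_nonneg _)
      (fun k => bfac_bound (ha' k) (ha k).2 (mem_unitDisk.mp hz) le_rfl) (hb.mul_left _)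
  obtain ⟨S, hS⟩ := prod_vanishing_of_summable_norm (hsum w hw) (ε := 1/2) (by norm_num)
  let f : ι → ℂ → ℂ := fun k z => if k ∈ S then 0 else bfac (a k) z - 1
  have hfle : ∀ k z, ‖f k z‖ ≤ ‖bfac (a k) z - 1‖ := fun k z => by
    by_cases h : k ∈ S <;> simp [f, h]
  have hfs : ∀ z ∈ unitDisk, Summable fun k => ‖f k z‖ := fun z hz =>
    Summable.of_nonneg_of_le (fun _ => norm_nonneg _) (fun k => hfle k z) (hsum z hz)
  have hfd : ∀ k, DifferentiableOn ℂ (f k) unitDisk := fun k => by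
    by_cases h : k ∈ S
    · simp only [f, h, if_true]; exact differentiableOn_const _
    · simp only [f, h, if_false]; exact (bfac_diff (ha' k)).sub_const _
  have hm : ∀ z ∈ unitDisk, Multipliable fun k => 1 + f k z := fun z hz =>
    multipliable_one_add_of_summable (hfs z hz)
  refine ⟨S, fun z => ∏' k, (1 + f k z), ?_, ?_, ?_⟩
  · intro z hz
    obtain ⟨ρ, h1, h2⟩ := exists_between (mem_unitDisk.mp hz)
    have hsub : ball (0:ℂ) ρ ⊆ unitDisk := ball_subset_ball h2.le
    have hp := Summable.hasProdLocallyUniformlyOn_one_add (f := f) (K := ball (0:ℂ) ρ) isOpen_ball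
      (hb.mul_left (2 / (1 - ρ)))
      (Eventually.of_forall fun k x hx => (hfle k x).trans
        (bfac_bound (ha' k) (ha k).2 h2 (by simpa using (mem_ball_zero_iff.mp hx).le)))
      (fun k => (hfd k).continuousOn.mono hsub)
    rw [hasProdLocallyUniformlyOn_iff_tendstoLocallyUniformlyOn] at hp
    have hd := hp.differentiableOn (Eventually.of_forall fun t =>
      DifferentiableOn.fun_finsetProd fun k _ => ((hfd k).mono hsub).const_add 1) isOpen_ball
    exact (hd.differentiableAt (isOpen_ball.mem_nhds (by simpa using h1))).differentiableWithinAt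
  · have ht := (hm w hw).hasProd
    have hle : ‖(∏' k, (1 + f k w)) - 1‖ ≤ 1 / 2 := by
      refine le_of_tendsto ((ht.sub_const 1).norm) (Eventually.of_forall fun t => ?_)
      have hd : Disjoint (t \ S) S := Finset.sdiff_disjoint
      have e : ∏ k ∈ t, (1 + f k w) = ∏ k ∈ t \ S, (1 + (bfac (a k) w - 1)) := by
        rw [← Finset.prod_subset (Finset.sdiff_subset (s := t) (t := S))]
        · refine Finset.prod_congr rfl fun k hk => ?_
          simp [f, (Finset.mem_sdiff.mp hk).2]
        · intro k hk hk'
          have : k ∈ S := by simpa [hk] using hk'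
          simp [f, this]
      rw [e]
      exact (hS _ hd).le
    have := norm_sub_norm_le (1:ℂ) (∏' k, (1 + f k w))
    rw [norm_one, norm_sub_rev] at this
    show 1 / 2 ≤ ‖∏' k, (1 + f k w)‖
    linarith
  · intro z hz
    have hmS : Multipliable fun k => if k ∈ S then bfac (a k) z else 1 := by
      apply multipliable_of_ne_finset_one (s := S)
      intro k hk; simp [hk]
    have : ∏ k ∈ S, bfac (a k) z = ∏' k, if k ∈ S then bfac (a k) z else 1 := by
      rw [tprod_eq_prod (s := S) (fun k hk => by simp [hk])]
      exact Finset.prod_congr rfl fun k hk => by simp [hk]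
    rw [this]
    show _ = _ * ∏' k, (1 + f k z)
    rw [← hmS.tprod_mul (hm z hz)]
    refine tprod_congr fun k => ?_
    by_cases h : k ∈ S <;> simp [f, h]

lemma finprod_tendsto {ι : Type*} (a : ι → ℂ) (ha : ∀ k, a k ∈ unitDisk ∧ a k ≠ 0) (m : ℕ)
    (S : Finset ι) : Tendsto (fun z => ‖z ^ m * ∏ k ∈ S, bfac (a k) z‖)
      (comap norm (nhdsWithin 1 (Iio 1))) (nhds 1) := by
  have h1 : Tendsto (fun z : ℂ => ‖z‖) (comap norm (nhdsWithin 1 (Iio 1))) (nhds 1) :=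
    tendsto_comap.mono_right nhdsWithin_le_nhds
  have h2 : ∀ k ∈ S, Tendsto (fun z : ℂ => ‖bfac (a k) z‖) (comap norm (nhdsWithin 1 (Iio 1))) (nhds 1) := by
    intro k _
    simp_rw [bfac_norm (ha k).2]
    exact (moebius_tendsto (mem_unitDisk.mp (ha k).1)).mono_right nhdsWithin_le_nhds
  have := (h1.pow m).mul (tendsto_finsetProd S h2)
  simpa [norm_mul, norm_pow, norm_prod] using this

lemma point_bound {p : ℝ} (hp0 : 0 < p) (hp1 : p < 1) {ι : Type*} (m : ℕ) (a : ι → ℂ)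
    (ha : ∀ k, a k ∈ unitDisk ∧ a k ≠ 0) (hb : Summable fun k => 1 - ‖a k‖)
    {f : ℂ → ℂ} (hf : DifferentiableOn ℂ f unitDisk)
    (hF : DifferentiableOn ℂ (fun z => blaschkeProduct m a z * f z) unitDisk)
    {C : ℝ} (hC0 : 0 ≤ C)
    (hC : ∀ w ∈ unitDisk, qpIntegral p (fun z => blaschkeProduct m a z * f z) w ≤ ENNReal.ofReal C)
    (k : ι) : 2 * π * (‖f (a k)‖ ^ 2 / 4) ≤ 4 * ((4 / (1 - p) + 100 * π) * C) := by
  obtain ⟨hk, hk0⟩ := ha k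
  have hk' := mem_unitDisk.mp hk
  set F := fun z => blaschkeProduct m a z * f z with hFdef
  obtain ⟨S, T, hT, hTk, hfac⟩ := tail_exists a ha hb hk
  have hfac' : ∀ z ∈ unitDisk, F z = (z ^ m * ∏ j ∈ S, bfac (a j) z) * (T z * f z) := by
    intro z hz
    have := hfac z hz
    simp only [hFdef, blaschkeProduct]
    simp only [bfac] at this ⊢
    rw [this]; ring
  have hmd : DifferentiableOn ℂ (moebius (a k)) unitDisk := fun z hz =>
    (moebius_diffAt hk' (mem_unitDisk.mp hz).le).differentiableWithinAt
  have hmaps : MapsTo (moebius (a k)) unitDisk unitDisk := fun z hz => moebius_mem hk hz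
  have hG : DifferentiableOn ℂ (fun z => F (moebius (a k) z)) unitDisk := hF.comp hmd hmaps
  have hh : DifferentiableOn ℂ (fun z => T (moebius (a k) z) * f (moebius (a k) z)) unitDisk :=
    (hT.comp hmd hmaps).mul (hf.comp hmd hmaps)
  have hG0 : F (moebius (a k) 0) = 0 := by
    rw [moebius_zero]
    have : ∏' j, bfac (a j) (a k) = 0 := by
      apply tprod_of_exists_eq_zero
      exact ⟨k, bfac_self _⟩
    simp only [bfac] at this
    simp only [hFdef, blaschkeProduct]
    rw [this]; ring
  have hlim := (finprod_tendsto a ha m S).comp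
    (tendsto_comap_iff.mpr (moebius_tendsto hk'))
  have hev := hlim.eventually (lt_mem_nhds (show (1/2:ℝ) < 1 by norm_num))
  rw [eventually_comap] at hev
  have hpos : ∀ᶠ r : ℝ in nhdsWithin 1 (Iio 1), 0 < r :=
    nhdsWithin_le_nhds (lt_mem_nhds one_pos)
  obtain ⟨r, ⟨hr, hr0⟩, hr1⟩ := ((hev.and hpos).and self_mem_nhdsWithin).exists
  have hr1' : r < 1 := hr1
  have hq := (conf_inv p F hF hk).trans (hC _ hk)
  have hup := h2_of_qp hp0 hp1 hG hC0 hq (r := r) ⟨hr0.le, hr1'⟩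
  have hlow := mvp (c := 0) (δ := 1) (r := r) hh hr0.le hr1'
  simp only [zero_add, moebius_zero] at hlow
  simp only [hG0, sub_zero] at hup
  have hc1 : Continuous fun t : ℝ => T (moebius (a k) (r * exp (I * t))) * f (moebius (a k) (r * exp (I * t))) := by
    have h := circ_cont (c := 0) (δ := 1) (r := r) hh.continuousOn hr0.le hr1'
    simpa only [zero_add] using h
  have hc2 : Continuous fun t : ℝ => F (moebius (a k) (r * exp (I * t))) := by
    have h := circ_cont (c := 0) (δ := 1) (r := r) hG.continuousOn hr0.le hr1'
    simpa only [zero_add] using h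
  have hmono : ∫ t in (0:ℝ)..(2*π), ‖T (moebius (a k) (r * exp (I * t))) * f (moebius (a k) (r * exp (I * t)))‖ ^ 2
      ≤ ∫ t in (0:ℝ)..(2*π), 4 * ‖F (moebius (a k) (r * exp (I * t)))‖ ^ 2 := by
    apply intervalIntegral.integral_mono_on (by positivity) ((hc1.norm.pow 2).intervalIntegrable _ _)
      (((hc2.norm.pow 2).const_mul 4).intervalIntegrable _ _)
    intro t _
    have hn := norm_rexp hr0.le t
    have hd : (r * exp (I * t) : ℂ) ∈ unitDisk := by rw [mem_unitDisk, hn]; exact hr1'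
    have hP := hr _ hn
    simp only [Function.comp] at hP
    show ‖T (moebius (a k) (r * exp (I * t))) * f (moebius (a k) (r * exp (I * t)))‖ ^ 2 ≤
      4 * ‖F (moebius (a k) (r * exp (I * t)))‖ ^ 2
    rw [hfac' _ (hmaps hd), norm_mul (moebius (a k) (r * exp (I * t)) ^ m * _)]
    generalize ‖moebius (a k) (r * exp (I * t)) ^ m * ∏ j ∈ S, bfac (a j) (moebius (a k) (r * exp (I * t)))‖ = x at *
    generalize ‖T (moebius (a k) (r * exp (I * t))) * f (moebius (a k) (r * exp (I * t)))‖ = y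
    have : (1/2:ℝ) ^ 2 ≤ x ^ 2 := by gcongr
    rw [mul_pow]
    nlinarith [sq_nonneg y]
  rw [intervalIntegral.integral_const_mul] at hmono
  have hTf : ‖f (a k)‖ ^ 2 / 4 ≤ ‖T (a k) * f (a k)‖ ^ 2 := by
    rw [norm_mul, mul_pow]
    have : (1/2:ℝ) ^ 2 ≤ ‖T (a k)‖ ^ 2 := by gcongr
    nlinarith [sq_nonneg ‖f (a k)‖]
  calc _ ≤ 2 * π * ‖T (a k) * f (a k)‖ ^ 2 := by gcongr
    _ ≤ _ := by linarith

lemma infinite_case {p : ℝ} (hp0 : 0 < p) (hp1 : p < 1) {ι : Type*} [Infinite ι] (m : ℕ) (a : ι → ℂ)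
    (ha : ∀ k, a k ∈ unitDisk ∧ a k ≠ 0) (hb : Summable fun k => 1 - ‖a k‖)
    (h : MemMQp p (blaschkeProduct m a)) : False := by
  have ha' : ∀ k, ‖a k‖ < 1 := fun k => mem_unitDisk.mp (ha k).1
  have hnorm : Tendsto (fun k => ‖a k‖) cofinite (nhds 1) := by
    have := (hb.tendsto_cofinite_zero).const_sub 1
    simpa using this
  obtain ⟨ζ, hζm, hζ⟩ := (isCompact_closedBall (0:ℂ) 1).exists_mapClusterPt (f := (cofinite : Filter ι)) (u := a)
    (by simp only [le_principal_iff, mem_map]; exact Eventually.of_forall fun k => by simpa using (ha' k).le)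
  have hζ1 : ‖ζ‖ = 1 := by
    have h1 : MapClusterPt ‖ζ‖ cofinite (fun k => ‖a k‖) := hζ.continuousAt_comp continuous_norm.continuousAt
    have h2 : ClusterPt ‖ζ‖ (nhds (1:ℝ)) := ClusterPt.mono h1 hnorm
    exact eq_of_nhds_neBot h2
  have hlog := log_mem hp0 hp1 hζ1
  obtain ⟨hFd, -, C, hC⟩ := h.2 _ hlog
  have hpb := point_bound hp0 hp1 m a ha hb hlog.1 hFd (le_max_right C 0)
    (fun w hw => (hC w hw).trans (ENNReal.ofReal_le_ofReal (le_max_left _ _)))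
  set Q := 4 * ((4 / (1 - p) + 100 * π) * max C 0) with hQ
  have hQ0 : 0 ≤ Q := by
    have : 0 < 1 - p := by linarith
    have := le_max_right C 0
    positivity
  have hε : 0 < Real.exp (-(Q + 1)) := Real.exp_pos _
  have hfr := hζ.frequently (ball_mem_nhds ζ hε)
  obtain ⟨k, hk⟩ := hfr.exists
  have hk2 : ‖ζ - a k‖ < Real.exp (-(Q + 1)) := by
    rw [← dist_eq_norm, dist_comm]; exact hk
  have hpos : 0 < ‖ζ - a k‖ := by
    have := norm_sub_norm_le ζ (a k)
    have := ha' k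
    linarith
  have hl : Real.log ‖ζ - a k‖ < -(Q + 1) := by
    rw [← Real.log_exp (-(Q+1))]; exact Real.log_lt_log hpos hk2
  have hre : Q + 1 ≤ ‖Complex.log (1 - (starRingEnd ℂ) ζ * a k)‖ := by
    refine le_trans ?_ (Complex.abs_re_le_norm _)
    rw [Complex.log_re, norm_log_arg hζ1]
    exact le_trans (by linarith) (neg_le_abs _)
  have := hpb k
  have hpi := Real.pi_gt_three
  generalize ‖Complex.log (1 - (starRingEnd ℂ) ζ * a k)‖ = y at *
  have h3 : (Q + 1) ^ 2 ≤ y ^ 2 := by gcongr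
  nlinarith [sq_nonneg y]

/-- For `0 < p < 1`, a Blaschke product belongs to the multiplier algebra `M(Q_p)` if and
only if it is a finite Blaschke product. -/
theorem blaschke_mem_MQp_iff_finite (p : ℝ) (hp0 : 0 < p) (hp1 : p < 1)
    {ι : Type*} (m : ℕ) (a : ι → ℂ)
    (ha : ∀ k, a k ∈ unitDisk ∧ a k ≠ 0)
    (hblaschke : Summable fun k => 1 - ‖a k‖) :
    MemMQp p (blaschkeProduct m a) ↔ Finite ι := by
  refine ⟨fun h => ?_, fun _ => finite_case hp0 m a ha⟩
  by_contra hfin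
  have : Infinite ι := not_finite_iff_infinite.mp hfin
  exact infinite_case hp0 hp1 m a ha hblaschke h

end
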